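/- Let H be a simple graph with chromatic number 3, and let g be the smallest positive integer such that there is no graph homomorphism from H to the cycle C_{2g+1}. Then for every η > 0 there exists N such that every H-free graph G on n ≥ N vertices with minimum degree at least (2/(2g+1) + η)·n has a spanning bipartite subgraph obtained by deleting at most η·n² edges. -/

import Mathlib

open SimpleGraph

/-- `H` has a copy in `G`: an injective graph homomorphism from `H` to `G`,
i.e. `G` contains a subgraph isomorphic to `H`. -/
def Copies {α β : Type*} (H : SimpleGraph α) (G : SimpleGraph β) : Prop :=
  ∃ f : H →g G, Function.Injective f

/-- A closed walk of odd length gives a homomorphism from the odd cycle. -/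
theorem hom_of_closed_walk {ι : Type*} {J : SimpleGraph ι} {v : ι} (w : J.Walk v v) (k : ℕ)
    (hk : 0 < k) (hw : w.length = 2 * k + 1) : Nonempty (cycleGraph (2 * k + 1) →g J) := by
  have key : ∀ a b : Fin (2 * k + 1), (b - a).val = 1 → J.Adj (w.getVert a) (w.getVert b) := by
    intro a b hab
    have ha := a.isLt
    have hb := b.isLt
    rw [Fin.sub_def] at hab
    simp only at hab
    by_cases h : a.val + 1 < 2 * k + 1
    · have : b.val = a.val + 1 := by
        by_cases hba : a.val ≤ b.val
        · rw [show 2 * k + 1 - a.val + b.val = (b.val - a.val) + (2 * k + 1) by omega,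
            Nat.add_mod_right, Nat.mod_eq_of_lt (by omega)] at hab
          omega
        · rw [Nat.mod_eq_of_lt (by omega)] at hab
          omega
      rw [this]
      exact w.adj_getVert_succ (by omega)
    · have ha' : a.val = 2 * k := by omega
      have : b.val = 0 := by
        rw [ha', show 2 * k + 1 - 2 * k + b.val = b.val + 1 by omega] at hab
        by_contra hne
        by_cases h2 : b.val + 1 < 2 * k + 1
        · rw [Nat.mod_eq_of_lt h2] at hab
          omega
        · rw [show b.val + 1 = 2 * k + 1 by omega, Nat.mod_self] at hab
          omega
      rw [this, w.getVert_zero, ha']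
      have h3 := w.adj_getVert_succ (i := 2 * k) (by omega)
      rwa [← hw, w.getVert_length] at h3
  refine ⟨⟨fun i => w.getVert i, ?_⟩⟩
  intro a b hab
  rw [cycleGraph_adj'] at hab
  rcases hab with hab | hab
  · exact (key _ _ hab).symm
  · exact key _ _ hab

theorem exists_subwalk {ι : Type*} {J : SimpleGraph ι} {u v : ι} (w : J.Walk u v) (a b : ℕ)
    (hab : a ≤ b) (hb : b ≤ w.length) :
    ∃ p : J.Walk (w.getVert a) (w.getVert b), p.length = b - a := by
  have h : (w.drop a).getVert (b - a) = w.getVert b := by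
    rw [Walk.drop_getVert]; congr 1; omega
  refine ⟨((w.drop a).take (b - a)).copy rfl h, ?_⟩
  rw [Walk.length_copy, Walk.take_length, Walk.drop_length]
  omega

open Classical in
/-- Andrásfai–Erdős–Sós. -/
theorem aes {ι : Type*} [Fintype ι] (J : SimpleGraph ι) (g : ℕ) (hg : 2 ≤ g)
    (hJ : ¬ J.Colorable 2)
    (hdeg : ∀ i, 2 * Fintype.card ι < (2 * g + 1) * (Finset.univ.filter fun j => J.Adj i j).card) :
    ∃ k, 0 < k ∧ k < g ∧ Nonempty (cycleGraph (2 * k + 1) →g J) := by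
  rw [two_colorable_iff_forall_loop_even] at hJ
  push Not at hJ
  obtain ⟨u0, w0, hw0⟩ := hJ
  have hex : ∃ L, Odd L ∧ ∃ u, ∃ w : J.Walk u u, w.length = L :=
    ⟨_, Nat.not_even_iff_odd.mp hw0, u0, w0, rfl⟩
  obtain ⟨hodd, u, w, hw⟩ := Nat.find_spec hex
  have hmin : ∀ x, ∀ p : J.Walk x x, Odd p.length → Nat.find hex ≤ p.length := fun x p hp =>
    Nat.find_min' hex ⟨hp, x, p, rfl⟩
  generalize Nat.find hex = L at *
  obtain ⟨k, rfl⟩ := hodd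
  have hk : 0 < k := by
    rcases Nat.eq_zero_or_pos k with rfl | h
    · exfalso
      have := w.adj_getVert_succ (i := 0) (by omega)
      have h2 := w.getVert_length
      rw [hw] at h2
      simp only [Walk.getVert_zero] at this
      simp only [mul_zero, zero_add] at h2 this
      rw [h2] at this
      exact J.irrefl this
    · exact h
  by_cases hkg : k < g
  · exact ⟨k, hk, hkg, hom_of_closed_walk w k hk hw⟩
  exfalso
  -- an odd arc between two neighbours of `x` is long
  have arc : ∀ x y z, J.Adj x y → J.Adj x z → ∀ p : J.Walk y z, Odd p.length →
      2 * k + 1 ≤ p.length + 2 := by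
    intro x y z hy hz p hp
    have := hmin x (Walk.cons hy (p.append (Walk.cons hz.symm Walk.nil))) (by
      simp only [Walk.length_cons, Walk.length_append, Walk.length_nil]
      obtain ⟨r, hr⟩ := hp
      exact ⟨r + 1, by omega⟩)
    simp only [Walk.length_cons, Walk.length_append, Walk.length_nil] at this
    omega
  have three : ∀ x, ∀ a b c : ℕ, a < b → b < c → c < 2 * k + 1 → J.Adj x (w.getVert a) →
      J.Adj x (w.getVert b) → J.Adj x (w.getVert c) → False := by
    intro x a b c hab hbc hc ha hb hc'
    obtain ⟨p1, hp1⟩ := exists_subwalk w a b hab.le (by omega)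
    obtain ⟨p2, hp2⟩ := exists_subwalk w b c hbc.le (by omega)
    have e1 := arc x _ _ ha hb p1
    have e2 := arc x _ _ hb hc' p2
    have e3 := arc x _ _ hc' ha ((w.drop c).append (w.take a))
    rw [Walk.length_append, Walk.drop_length, Walk.take_length] at e3
    rw [hp1] at e1
    rw [hp2] at e2
    rw [hw, min_eq_left (by omega)] at e3
    simp only [Nat.odd_iff] at e1 e2 e3
    omega
  have two : ∀ x, ((Finset.range (2 * k + 1)).filter fun i => J.Adj x (w.getVert i)).card ≤ 2 := by
    intro x
    by_contra hcon
    push Not at hcon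
    obtain ⟨a, b, c, ha, hb, hc, hab, hac, hbc⟩ := Finset.two_lt_card_iff.mp hcon
    simp only [Finset.mem_filter, Finset.mem_range] at ha hb hc
    have T := three x
    rcases lt_trichotomy a b with h1 | h1 | h1 <;> rcases lt_trichotomy b c with h2 | h2 | h2 <;>
      rcases lt_trichotomy a c with h3 | h3 | h3 <;> first | omega | skip
    · exact T a b c h1 h2 hc.1 ha.2 hb.2 hc.2
    · exact T a c b h3 h2 hb.1 ha.2 hc.2 hb.2
    · exact T c a b h3 h1 hb.1 hc.2 ha.2 hb.2
    · exact T b a c h1 h3 hc.1 hb.2 ha.2 hc.2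
    · exact T b c a h2 h3 ha.1 hb.2 hc.2 ha.2
    · exact T c b a h2 h1 ha.1 hc.2 hb.2 ha.2
  have dc := Finset.sum_card_bipartiteAbove_eq_sum_card_bipartiteBelow
    (s := Finset.range (2 * k + 1)) (t := (Finset.univ : Finset ι))
    (fun i x => J.Adj x (w.getVert i))
  simp only [Finset.bipartiteAbove, Finset.bipartiteBelow] at dc
  have up : ∑ x : ι, ((Finset.range (2 * k + 1)).filter fun i => J.Adj x (w.getVert i)).card
      ≤ Fintype.card ι * 2 := by
    simpa using Finset.sum_le_card_nsmul Finset.univ _ 2 (fun x _ => two x)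
  have lo : ∑ i ∈ Finset.range (2 * k + 1), (2 * Fintype.card ι + 1) ≤
      ∑ i ∈ Finset.range (2 * k + 1), (2 * g + 1) *
        (Finset.univ.filter fun x => J.Adj x (w.getVert i)).card := by
    refine Finset.sum_le_sum fun i _ => ?_
    have := hdeg (w.getVert i)
    simp only [J.adj_comm (w.getVert i)] at this
    omega
  rw [← Finset.mul_sum, dc, Finset.sum_const, Finset.card_range, smul_eq_mul] at lo
  nlinarith [Nat.mul_le_mul_left (2 * g + 1) up, Nat.zero_le (Fintype.card ι)]

open Classical in
theorem card_eq_coord (n r : ℕ) (i j : Fin (r + 1)) (hij : i ≠ j) :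
    (Finset.univ.filter fun x : Fin (r + 1) → Fin n => x i = x j).card ≤ n ^ r := by
  have : (Finset.univ : Finset ({l : Fin (r + 1) // l ≠ i} → Fin n)).card = n ^ r := by
    simp [Fintype.card_subtype_compl]
  rw [← this]
  refine Finset.card_le_card_of_injOn (fun x l => x l.1) (fun _ _ => Finset.mem_coe.2 (Finset.mem_univ _)) ?_
  intro x hx y hy hxy
  simp only [Finset.coe_filter, Finset.mem_univ, true_and, Set.mem_ofPred_eq] at hx hy
  have h : ∀ l, l ≠ i → x l = y l := fun l hl => congrFun hxy ⟨l, hl⟩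
  funext l
  by_cases hl : l = i
  · rw [hl, hx, hy, h j hij.symm]
  · exact h l hl

open Classical in
theorem card_noninj (n r : ℕ) :
    (Finset.univ.filter fun x : Fin (r + 1) → Fin n => ¬ Function.Injective x).card
      ≤ (r + 1) ^ 2 * n ^ r := by
  have hsub : (Finset.univ.filter fun x : Fin (r + 1) → Fin n => ¬ Function.Injective x) ⊆
      (Finset.univ : Finset (Fin (r + 1) × Fin (r + 1))).biUnion fun p =>
        if p.1 = p.2 then ∅ else Finset.univ.filter fun x : Fin (r + 1) → Fin n => x p.1 = x p.2 := by
    intro x hx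
    have hx := (Finset.mem_filter.mp hx).2
    unfold Function.Injective at hx
    push Not at hx
    obtain ⟨a, b, hab, hne⟩ := hx
    simp only [Finset.mem_biUnion, Finset.mem_univ, true_and]
    exact ⟨(a, b), by simp [hne, hab]⟩
  refine (Finset.card_le_card hsub).trans (Finset.card_biUnion_le.trans ?_)
  have : ∀ p ∈ (Finset.univ : Finset (Fin (r + 1) × Fin (r + 1))),
      (if p.1 = p.2 then ∅ else
        Finset.univ.filter fun x : Fin (r + 1) → Fin n => x p.1 = x p.2).card ≤ n ^ r := by
    intro p _
    split_ifs with h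
    · simp
    · exact card_eq_coord n r p.1 p.2 h
  refine (Finset.sum_le_card_nsmul _ _ _ this).trans ?_
  simp [sq]

open Classical in
theorem box (t : ℕ) : ∀ (k : ℕ) (c : ℝ), 0 < c → ∃ N : ℕ, ∀ n : ℕ, N ≤ n →
    ∀ S : Finset (Fin k → Fin n), c * (n : ℝ) ^ k ≤ S.card →
    ∃ A : Fin k → Finset (Fin n), (∀ i, t ≤ (A i).card) ∧ ∀ f, (∀ i, f i ∈ A i) → f ∈ S := by
  intro k
  induction k with
  | zero =>
    intro c hc
    refine ⟨0, fun n _ S hS => ⟨fun _ => ∅, fun i => i.elim0, fun f _ => ?_⟩⟩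
    have : 0 < (S.card : ℝ) := lt_of_lt_of_le (by simpa using hc) hS
    obtain ⟨s, hs⟩ := Finset.card_pos.mp (by exact_mod_cast this)
    rwa [Subsingleton.elim f s]
  | succ k ih =>
    intro c hc
    obtain ⟨N, hN⟩ := ih (c ^ (t + 1) / 2) (by positivity)
    obtain ⟨M, hM⟩ := exists_nat_gt (4 * ((t : ℝ) + 1) ^ 2 / c ^ (t + 1))
    refine ⟨max N (M + 1), fun n hn S hS => ?_⟩
    have hnN : N ≤ n := le_trans (le_max_left _ _) hn
    have hnM : M + 1 ≤ n := le_trans (le_max_right _ _) hn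
    have hn0 : (0 : ℝ) < n := by exact_mod_cast (by omega : 0 < n)
    have hnM' : 4 * ((t : ℝ) + 1) ^ 2 ≤ c ^ (t + 1) * n := by
      rw [div_lt_iff₀ (by positivity)] at hM
      have : (M : ℝ) ≤ n := by exact_mod_cast (by omega : M ≤ n)
      have h2 : (M : ℝ) * c ^ (t + 1) ≤ n * c ^ (t + 1) := by gcongr
      linarith
    let d : (Fin k → Fin n) → ℕ := fun y =>
      (Finset.univ.filter fun x : Fin n => (Fin.cons x y : Fin (k + 1) → Fin n) ∈ S).card
    let T : (Fin (t + 1) → Fin n) → Finset (Fin k → Fin n) := fun x =>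
      Finset.univ.filter fun y => ∀ j, (Fin.cons (x j) y : Fin (k + 1) → Fin n) ∈ S
    have hsum : ∑ y, (d y : ℝ) = S.card := by
      have h1 : S.card = ∑ f : Fin (k + 1) → Fin n, if f ∈ S then 1 else 0 := by simp
      rw [h1, ← (Fin.consEquiv fun _ : Fin (k + 1) => Fin n).sum_comp, Fintype.sum_prod_type_right]
      push_cast
      refine Finset.sum_congr rfl fun y _ => ?_
      simp only [d, Fin.consEquiv]
      rw [Finset.card_filter]
      push_cast
      rfl
    have hpow := pow_sum_div_card_le_sum_pow (s := Finset.univ) (f := fun y => (d y : ℝ))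
      (fun _ _ => Nat.cast_nonneg _) t
    have hdT : ∑ y, (d y : ℝ) ^ (t + 1) = ∑ x, ((T x).card : ℝ) := by
      have h2 : ∀ y, d y ^ (t + 1) = (Finset.univ.filter fun x : Fin (t + 1) → Fin n =>
          ∀ j, (Fin.cons (x j) y : Fin (k + 1) → Fin n) ∈ S).card := by
        intro y
        have : (Finset.univ.filter fun x : Fin (t + 1) → Fin n =>
          ∀ j, (Fin.cons (x j) y : Fin (k + 1) → Fin n) ∈ S) = Fintype.piFinset fun _ : Fin (t + 1) =>
            Finset.univ.filter fun x : Fin n => (Fin.cons x y : Fin (k + 1) → Fin n) ∈ S := by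
          ext x; simp
        rw [this, Fintype.card_piFinset]
        simp [d]
      have dc := Finset.sum_card_bipartiteAbove_eq_sum_card_bipartiteBelow
        (s := (Finset.univ : Finset (Fin k → Fin n)))
        (t := (Finset.univ : Finset (Fin (t + 1) → Fin n)))
        (fun y x => ∀ j, (Fin.cons (x j) y : Fin (k + 1) → Fin n) ∈ S)
      simp only [Finset.bipartiteAbove, Finset.bipartiteBelow] at dc
      rw [← Nat.cast_sum, ← dc]
      push_cast
      refine Finset.sum_congr rfl fun y _ => ?_
      rw [← h2]
      push_cast
      rfl
    rw [hsum, hdT] at hpow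
    have hlow : c ^ (t + 1) * (n : ℝ) ^ (t + 1) * n ^ k ≤ ∑ x, ((T x).card : ℝ) := by
      refine le_trans ?_ hpow
      rw [le_div_iff₀ (by simp; positivity)]
      have h3 : (c * (n : ℝ) ^ (k + 1)) ^ (t + 1) ≤ (S.card : ℝ) ^ (t + 1) := by gcongr
      refine le_trans (le_of_eq ?_) h3
      simp
      ring
    have hx : ∃ x : Fin (t + 1) → Fin n, Function.Injective x ∧
        c ^ (t + 1) / 2 * (n : ℝ) ^ k ≤ (T x).card := by
      by_contra hcon
      push Not at hcon
      have hb : ∀ x ∈ (Finset.univ : Finset (Fin (t + 1) → Fin n)), ((T x).card : ℝ) ≤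
          c ^ (t + 1) / 2 * (n : ℝ) ^ k + if ¬ Function.Injective x then (n : ℝ) ^ k else 0 := by
        intro x _
        by_cases hxi : Function.Injective x
        · simp [hxi, (hcon x hxi).le]
        · have : (T x).card ≤ n ^ k := by
            refine (Finset.card_le_univ _).trans ?_
            simp
          have : ((T x).card : ℝ) ≤ (n : ℝ) ^ k := by exact_mod_cast this
          simp only [hxi, not_false_eq_true, if_true]
          have : 0 ≤ c ^ (t + 1) / 2 * (n : ℝ) ^ k := by positivity
          linarith
      have h4 := Finset.sum_le_sum hb
      rw [Finset.sum_add_distrib, ← Finset.sum_filter] at h4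
      simp only [Finset.sum_const, Finset.card_univ, Fintype.card_pi, Fintype.card_fin,
        Finset.prod_const, nsmul_eq_mul] at h4
      have h5 : ((Finset.univ.filter fun x : Fin (t + 1) → Fin n => ¬ Function.Injective x).card : ℝ)
          ≤ ((t : ℝ) + 1) ^ 2 * n ^ t := by exact_mod_cast card_noninj n t
      have h6 : ((Finset.univ.filter fun x : Fin (t + 1) → Fin n => ¬ Function.Injective x).card : ℝ)
          * (n : ℝ) ^ k ≤ c ^ (t + 1) / 4 * (n : ℝ) ^ (t + 1) * n ^ k := by
        gcongr
        refine h5.trans ?_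
        rw [pow_succ (n : ℝ) t]
        have : 0 < (n : ℝ) ^ t := by positivity
        nlinarith
      have h7 : 0 < c ^ (t + 1) * (n : ℝ) ^ (t + 1) * n ^ k := by positivity
      push_cast at h4
      nlinarith
    obtain ⟨x, hxi, hxT⟩ := hx
    obtain ⟨A, hA, hAT⟩ := hN n hnN (T x) hxT
    refine ⟨Fin.cons (Finset.univ.image x) A, ?_, ?_⟩
    · intro i
      refine Fin.cases ?_ (fun i => ?_) i
      · simp [Finset.card_image_of_injective _ hxi]
      · simpa using hA i
    · intro f hf
      have h0 := hf 0
      simp only [Fin.cons_zero, Finset.mem_image, Finset.mem_univ, true_and] at h0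
      obtain ⟨j, hj⟩ := h0
      have h1 := hAT (Fin.tail f) (fun i => by simpa [Fin.tail] using hf i.succ)
      simp only [T, Finset.mem_filter, Finset.mem_univ, true_and] at h1
      have h2 := h1 j
      rwa [hj, Fin.cons_self_tail] at h2

open Classical in
/-- Positive density of homomorphic images yields a copy. -/
theorem copy_of_density {α ι : Type*} [Fintype α] [Fintype ι] [DecidableEq ι] (H : SimpleGraph α) (h : α → ι)
    (c : ℝ) (hc : 0 < c) : ∃ N : ℕ, ∀ n : ℕ, N ≤ n → ∀ G : SimpleGraph (Fin n),
      c * (n : ℝ) ^ Fintype.card ι ≤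
        (Finset.univ.filter fun f : ι → Fin n => ∀ a b, H.Adj a b → G.Adj (f (h a)) (f (h b))).card →
      ∃ f : H →g G, Function.Injective f := by
  obtain ⟨N, hN⟩ := box (Fintype.card α + 1) (Fintype.card ι) c hc
  refine ⟨N, fun n hn G hS => ?_⟩
  let e := Fintype.equivFin ι
  obtain ⟨A, hA, hAS⟩ := hN n hn (Finset.univ.filter fun f : Fin (Fintype.card ι) → Fin n =>
      ∀ a b, H.Adj a b → G.Adj (f (e (h a))) (f (e (h b)))) (by
    refine hS.trans ?_
    norm_cast
    refine Finset.card_le_card_of_injOn (fun f => f ∘ e.symm) ?_ ?_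
    · intro f hf
      simpa using hf
    · intro f _ f' _ hff
      funext i
      have := congrFun hff (e i)
      simpa using this)
  have hall : ∃ r : α → Fin n, Function.Injective r ∧ ∀ a, r a ∈ A (e (h a)) := by
    rw [← Finset.all_card_le_biUnion_card_iff_exists_injective]
    intro s
    rcases s.eq_empty_or_nonempty with rfl | ⟨a, ha⟩
    · simp
    · calc s.card ≤ Fintype.card α := Finset.card_le_univ _
        _ ≤ (A (e (h a))).card := by have := hA (e (h a)); omega
        _ ≤ _ := Finset.card_le_card (Finset.subset_biUnion_of_mem (fun a => A (e (h a))) ha)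
  obtain ⟨r, hr, hrA⟩ := hall
  have hne : ∀ i, (A i).Nonempty := fun i => Finset.card_pos.mp (by have := hA i; omega)
  choose z hz using hne
  have hadj : ∀ a b, H.Adj a b → h a ≠ h b := by
    intro a b hab heq
    have := hAS z hz
    simp only [Finset.mem_filter, Finset.mem_univ, true_and] at this
    have := this a b hab
    rw [heq] at this
    exact G.irrefl this
  refine ⟨⟨r, ?_⟩, hr⟩
  intro a b hab
  have hx := hAS (Function.update (Function.update z (e (h a)) (r a)) (e (h b)) (r b)) (by
    intro i
    by_cases h1 : i = e (h b)
    · subst h1; simpa using hrA b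
    · by_cases h2 : i = e (h a)
      · subst h2; simpa [Function.update_of_ne h1] using hrA a
      · simpa [Function.update_of_ne h1, Function.update_of_ne h2] using hz i)
  simp only [Finset.mem_filter, Finset.mem_univ, true_and] at hx
  have := hx a b hab
  rw [Function.update_self, Function.update_of_ne (by simpa using hadj a b hab),
    Function.update_self] at this
  exact this

open Classical in
theorem chernoff {ι : Type*} [Fintype ι] [DecidableEq ι] (n : ℕ) (G : SimpleGraph (Fin n)) (q η : ℝ)
    (hq : 0 ≤ q) (hη : 0 < η) (hp : q + η ≤ 1)
    (hdeg : ∀ v, (q + η) * n ≤ ((Finset.univ.filter fun w => G.Adj v w).card : ℝ)) (i : ι) :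
    ((Finset.univ.filter fun f : ι → Fin n =>
      ((Finset.univ.filter fun j => G.Adj (f i) (f j)).card : ℝ) ≤ q * Fintype.card ι).card : ℝ)
      ≤ (n : ℝ) ^ Fintype.card ι * (Real.exp 1 * Real.exp (-(η ^ 2 / 4)) ^ Fintype.card ι) := by
  obtain ⟨m', hm'⟩ : ∃ m', Fintype.card ι = m' + 1 :=
    ⟨Fintype.card ι - 1, by have := Fintype.card_pos_iff.mpr ⟨i⟩; omega⟩
  set m := Fintype.card ι with hm
  set x := Real.exp (-(η / 2)) with hx
  have hx0 : 0 < x := Real.exp_pos _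
  have hx1 : x ≤ 1 := Real.exp_le_one_iff.mpr (by linarith)
  let φ : Fin n → ι → Fin n → ℝ := fun v j w =>
    if j = i then (if w = v then 1 else 0) else (if G.Adj v w then x else 1)
  have hφ0 : ∀ v j w, 0 ≤ φ v j w := by
    intro v j w
    simp only [φ]
    split_ifs <;> first | exact hx0.le | norm_num
  -- pointwise bound
  have hpt : ∀ f ∈ (Finset.univ.filter fun f : ι → Fin n =>
      ((Finset.univ.filter fun j => G.Adj (f i) (f j)).card : ℝ) ≤ q * m),
      (1 : ℝ) ≤ Real.exp (η / 2 * (q * m)) * ∑ v, ∏ j, φ v j (f j) := by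
    intro f hf
    have hf := (Finset.mem_filter.mp hf).2
    have h1 : ∏ j, φ (f i) j (f j) ≤ ∑ v, ∏ j, φ v j (f j) :=
      Finset.single_le_sum (f := fun v => ∏ j, φ v j (f j))
        (fun v _ => Finset.prod_nonneg fun j _ => hφ0 _ _ _) (Finset.mem_univ (f i))
    have h2 : ∏ j, φ (f i) j (f j) = x ^ (Finset.univ.filter fun j => G.Adj (f i) (f j)).card := by
      rw [← Finset.prod_const, Finset.prod_filter]
      refine Finset.prod_congr rfl fun j _ => ?_
      simp only [φ]
      by_cases hj : j = i
      · subst hj; simp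
      · simp [hj]
    have h3 : x ^ (Finset.univ.filter fun j => G.Adj (f i) (f j)).card =
        Real.exp (-(η / 2) * (Finset.univ.filter fun j => G.Adj (f i) (f j)).card) := by
      rw [hx, ← Real.exp_nat_mul]; ring_nf
    calc (1 : ℝ) ≤ Real.exp (η / 2 * (q * m) +
          -(η / 2) * (Finset.univ.filter fun j => G.Adj (f i) (f j)).card) := by
          apply Real.one_le_exp
          nlinarith
      _ = Real.exp (η / 2 * (q * m)) * ∏ j, φ (f i) j (f j) := by rw [Real.exp_add, h2, h3]
      _ ≤ _ := by gcongr
  have hsum := Finset.sum_le_sum hpt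
  rw [Finset.sum_const, nsmul_eq_mul, mul_one] at hsum
  refine hsum.trans ?_
  have hsum2 : ∑ f ∈ (Finset.univ.filter fun f : ι → Fin n =>
      ((Finset.univ.filter fun j => G.Adj (f i) (f j)).card : ℝ) ≤ q * m),
      Real.exp (η / 2 * (q * m)) * ∑ v, ∏ j, φ v j (f j) ≤
      ∑ f : ι → Fin n, Real.exp (η / 2 * (q * m)) * ∑ v, ∏ j, φ v j (f j) :=
    Finset.sum_le_sum_of_subset_of_nonneg (Finset.filter_subset _ _) (fun f _ _ =>
      mul_nonneg (Real.exp_pos _).le (Finset.sum_nonneg fun v _ =>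
        Finset.prod_nonneg fun j _ => hφ0 _ _ _))
  refine hsum2.trans ?_
  rw [← Finset.mul_sum, Finset.sum_comm]
  have hrow : ∀ v j, j ≠ i → ∑ w, φ v j w ≤ n * Real.exp (-((q + η) * (1 - x))) := by
    intro v j hj
    have h1 : ∑ w, φ v j w = n - (1 - x) * (Finset.univ.filter fun w => G.Adj v w).card := by
      have : ∀ w, φ v j w = 1 - (1 - x) * (if G.Adj v w then 1 else 0) := by
        intro w
        simp only [φ, hj, if_false]
        split_ifs <;> ring
      simp only [this]
      rw [Finset.sum_sub_distrib, ← Finset.mul_sum]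
      simp
    rw [h1]
    have h2 := Real.add_one_le_exp (-((q + η) * (1 - x)))
    have h3 := mul_le_mul_of_nonneg_left (hdeg v) (by linarith : 0 ≤ 1 - x)
    have h4 := mul_le_mul_of_nonneg_left h2 (Nat.cast_nonneg n : (0 : ℝ) ≤ n)
    nlinarith
  have hv : ∀ v ∈ (Finset.univ : Finset (Fin n)), ∑ f : ι → Fin n, ∏ j, φ v j (f j) ≤
      (n * Real.exp (-((q + η) * (1 - x)))) ^ m' := by
    intro v _
    rw [← Fintype.prod_sum, ← Finset.mul_prod_erase _ _ (Finset.mem_univ i)]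
    have h1 : ∑ w, φ v i w = 1 := by simp [φ]
    rw [h1, one_mul]
    have : (Finset.univ.erase i).card = m' := by
      rw [Finset.card_erase_of_mem (Finset.mem_univ i), Finset.card_univ]; omega
    rw [← this, ← Finset.prod_const]
    exact Finset.prod_le_prod (fun j _ => Finset.sum_nonneg fun w _ => hφ0 _ _ _)
      (fun j hj => hrow v j (Finset.ne_of_mem_erase hj))
  have hS := Finset.sum_le_sum hv
  rw [Finset.sum_const, Finset.card_univ, Fintype.card_fin, nsmul_eq_mul] at hS
  refine (mul_le_mul_of_nonneg_left hS (Real.exp_pos _).le).trans ?_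
  have e1 : Real.exp (η / 2 * (q * m)) * (n * (n * Real.exp (-((q + η) * (1 - x)))) ^ m') =
      (n : ℝ) ^ m * Real.exp (η / 2 * (q * m) + m' * (-((q + η) * (1 - x)))) := by
    rw [hm', mul_pow, ← Real.exp_nat_mul, Real.exp_add, pow_succ]; ring
  rw [e1, ← Real.exp_nat_mul, ← Real.exp_add]
  refine mul_le_mul_of_nonneg_left (Real.exp_le_exp.mpr ?_) (by positivity)
  have hxx : η / 2 - (η / 2) ^ 2 ≤ 1 - x := by
    have := Real.abs_exp_sub_one_sub_id_le (x := -(η / 2)) (by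
      rw [abs_neg, abs_of_pos (by linarith)]; linarith)
    have := (abs_le.mp this).2
    rw [← hx] at this
    nlinarith
  have hmm : (m : ℝ) = m' + 1 := by rw [hm']; push_cast; rfl
  have hm0 : (0 : ℝ) ≤ m := Nat.cast_nonneg _
  have h5 : (q + η) * (1 - x) ≤ 1 := by nlinarith
  have h6 : η / 2 * q - (q + η) * (1 - x) ≤ -(η ^ 2 / 4) := by
    have := mul_le_mul_of_nonneg_left hxx (by linarith : 0 ≤ q + η)
    nlinarith [mul_le_mul_of_nonneg_right hp (sq_nonneg (η / 2))]
  have h7 := mul_le_mul_of_nonneg_left h6 hm0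
  have : (m' : ℝ) = m - 1 := by linarith
  rw [this]
  nlinarith

open Classical in
theorem bad_card (n u : ℕ) (hn : 0 < n) (G : SimpleGraph (Fin n)) (η : ℝ) (hη : 0 < η)
    (hdeg : ∀ v, η * n ≤ ((Finset.univ.filter fun w => G.Adj v w).card : ℝ)) :
    ((Finset.univ.filter fun U : Fin u → Fin n => η / 4 * n <
      ((Finset.univ.filter fun v => ∀ i, ¬ G.Adj v (U i)).card : ℝ)).card : ℝ) ≤
      (n : ℝ) ^ u * (4 / η * (1 - η) ^ u) := by
  have hn' : (0 : ℝ) < n := by exact_mod_cast hn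
  set B := Finset.univ.filter fun U : Fin u → Fin n => η / 4 * n <
      ((Finset.univ.filter fun v => ∀ i, ¬ G.Adj v (U i)).card : ℝ) with hB
  have dc := Finset.sum_card_bipartiteAbove_eq_sum_card_bipartiteBelow
    (s := (Finset.univ : Finset (Fin u → Fin n))) (t := (Finset.univ : Finset (Fin n)))
    (fun U v => ∀ i, ¬ G.Adj v (U i))
  simp only [Finset.bipartiteAbove, Finset.bipartiteBelow] at dc
  have hv : ∀ v ∈ (Finset.univ : Finset (Fin n)),
      ((Finset.univ.filter fun U : Fin u → Fin n => ∀ i, ¬ G.Adj v (U i)).card : ℝ) ≤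
      ((1 - η) * n) ^ u := by
    intro v _
    have h1 : (Finset.univ.filter fun U : Fin u → Fin n => ∀ i, ¬ G.Adj v (U i)) =
        Fintype.piFinset fun _ : Fin u => Finset.univ.filter fun w => ¬ G.Adj v w := by
      ext U; simp
    rw [h1, Fintype.card_piFinset]
    simp only [Finset.prod_const, Finset.card_univ, Fintype.card_fin]
    push_cast
    gcongr
    have h2 := Finset.card_filter_add_card_filter_not (s := (Finset.univ : Finset (Fin n)))
      (fun w => G.Adj v w)
    rw [Finset.card_univ, Fintype.card_fin] at h2
    have h3 : ((Finset.univ.filter fun w => G.Adj v w).card : ℝ) +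
      ((Finset.univ.filter fun w => ¬ G.Adj v w).card : ℝ) = n := by exact_mod_cast h2
    linarith [hdeg v]
  have hS := Finset.sum_le_sum hv
  rw [Finset.sum_const, Finset.card_univ, Fintype.card_fin, nsmul_eq_mul, ← Nat.cast_sum, ← dc,
    Nat.cast_sum] at hS
  have hlow : (B.card : ℝ) * (η / 4 * n) ≤ ∑ U : Fin u → Fin n,
      ((Finset.univ.filter fun v => ∀ i, ¬ G.Adj v (U i)).card : ℝ) := by
    rw [← nsmul_eq_mul, ← Finset.sum_const]
    refine (Finset.sum_le_sum (fun U hU => ?_)).trans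
      (Finset.sum_le_sum_of_subset_of_nonneg (Finset.subset_univ B) (fun _ _ _ => Nat.cast_nonneg _))
    exact (Finset.mem_filter.mp hU).2.le
  have h4 := hlow.trans hS
  rw [mul_pow] at h4
  have h5 : (B.card : ℝ) * (η / 4) ≤ (1 - η) ^ u * n ^ u := by
    refine le_of_mul_le_mul_right ?_ hn'
    linarith
  rw [show (n : ℝ) ^ u * (4 / η * (1 - η) ^ u) = ((1 - η) ^ u * n ^ u) / (η / 4) by
    field_simp]
  rwa [le_div_iff₀ (by positivity)]

open Classical in
theorem viol_card (n u : ℕ) (G : SimpleGraph (Fin n)) (η : ℝ)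
    (hfar : ∀ G' : SimpleGraph (Fin n), G' ≤ G → G'.Colorable 2 →
      η * n ^ 2 < ((G.edgeSet \ G'.edgeSet).ncard : ℝ))
    (U : Fin u → Fin n) (c : Fin u → Bool)
    (hU : ((Finset.univ.filter fun v => ∀ i, ¬ G.Adj v (U i)).card : ℝ) ≤ η / 4 * n) :
    η / 2 * n ^ 2 ≤ ((Finset.univ.filter fun z : Fin n × Fin n => G.Adj z.1 z.2 ∧
      ∃ b, (∃ i, c i = b ∧ G.Adj z.1 (U i)) ∧ (∃ i, c i = b ∧ G.Adj z.2 (U i))).card : ℝ) := by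
  set bad := Finset.univ.filter fun v => ∀ i, ¬ G.Adj v (U i) with hbad
  set W := Finset.univ.filter fun z : Fin n × Fin n => G.Adj z.1 z.2 ∧
      ∃ b, (∃ i, c i = b ∧ G.Adj z.1 (U i)) ∧ (∃ i, c i = b ∧ G.Adj z.2 (U i)) with hW
  let A : Fin n → Prop := fun v => ∃ i, c i = true ∧ G.Adj v (U i)
  let G' : SimpleGraph (Fin n) :=
    { Adj := fun x y => G.Adj x y ∧ ¬ (A x ↔ A y)
      symm := ⟨fun x y h => ⟨h.1.symm, fun h' => h.2 h'.symm⟩⟩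
      loopless := ⟨fun x h => h.2 Iff.rfl⟩ }
  have hcol : G'.Colorable 2 := by
    let C : G'.Coloring Bool := Coloring.mk (fun v => decide (A v)) (by
      intro v w hvw heq
      exact hvw.2 (by simpa using heq))
    simpa using C.colorable
  have h1 := hfar G' (fun x y h => h.1) hcol
  have hsub : G.edgeSet \ G'.edgeSet ⊆
      (((W ∪ (bad ×ˢ Finset.univ ∪ Finset.univ ×ˢ bad)).image fun z => s(z.1, z.2)) :
        Finset (Sym2 (Fin n))) := by
    intro e
    induction e using Sym2.ind with
    | _ x y =>
      intro he
      have hxy : G.Adj x y := he.1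
      have hAA : (A x ↔ A y) := by
        by_contra h
        exact he.2 (show G'.Adj x y from ⟨hxy, h⟩)
      simp only [Finset.coe_image, Set.mem_image, Finset.mem_coe]
      refine ⟨(x, y), ?_, rfl⟩
      by_cases hbx : x ∈ bad
      · simp [hbx]
      by_cases hby : y ∈ bad
      · simp [hby]
      refine Finset.mem_union_left _ (Finset.mem_filter.mpr ⟨Finset.mem_univ _, hxy, ?_⟩)
      by_cases hAx : A x
      · exact ⟨true, hAx, hAA.mp hAx⟩
      · refine ⟨false, ?_, ?_⟩
        · have : ∃ i, G.Adj x (U i) := by simpa [hbad] using hbx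
          obtain ⟨i, hi⟩ := this
          refine ⟨i, ?_, hi⟩
          by_contra hc
          exact hAx ⟨i, by simpa using hc, hi⟩
        · have : ∃ i, G.Adj y (U i) := by simpa [hbad] using hby
          obtain ⟨i, hi⟩ := this
          refine ⟨i, ?_, hi⟩
          by_contra hc
          exact hAx (hAA.mpr ⟨i, by simpa using hc, hi⟩)
  have h2 := Set.ncard_le_ncard hsub (Finset.finite_toSet _)
  rw [Set.ncard_coe_finset] at h2
  have h3 : (G.edgeSet \ G'.edgeSet).ncard ≤ W.card + (bad.card * n + n * bad.card) := by
    refine h2.trans (Finset.card_image_le.trans ((Finset.card_union_le _ _).trans ?_))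
    refine Nat.add_le_add_left ((Finset.card_union_le _ _).trans ?_) _
    simp
  have h4 : ((G.edgeSet \ G'.edgeSet).ncard : ℝ) ≤ W.card + (bad.card * n + n * bad.card) := by
    exact_mod_cast h3
  have hn0 : (0 : ℝ) ≤ n := Nat.cast_nonneg n
  nlinarith [mul_le_mul_of_nonneg_right hU hn0]

open Classical in
theorem bip_card (n u s : ℕ) (hn : 0 < n) (G : SimpleGraph (Fin n)) (η : ℝ) (hη : 0 < η)
    (hη1 : η ≤ 1)
    (hdeg : ∀ v, η * n ≤ ((Finset.univ.filter fun w => G.Adj v w).card : ℝ))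
    (hfar : ∀ G' : SimpleGraph (Fin n), G' ≤ G → G'.Colorable 2 →
      η * n ^ 2 < ((G.edgeSet \ G'.edgeSet).ncard : ℝ)) :
    ((Finset.univ.filter fun f : Fin u ⊕ (Fin s ⊕ Fin s) → Fin n =>
      (G.comap f).Colorable 2).card : ℝ) ≤
      (n : ℝ) ^ (u + (s + s)) * (4 / η * (1 - η) ^ u + 2 ^ u * (1 - η / 2) ^ s) := by
  let e : (Fin u ⊕ (Fin s ⊕ Fin s) → Fin n) ≃ (Fin u → Fin n) × (Fin s → Fin n × Fin n) :=
    (Equiv.sumArrowEquivProdArrow _ _ _).trans (Equiv.prodCongr (Equiv.refl _)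
      ((Equiv.sumArrowEquivProdArrow _ _ _).trans (Equiv.arrowProdEquivProdArrow _ _ _).symm))
  let Q : (Fin u → Fin n) → (Fin s → Fin n × Fin n) → Prop := fun U P =>
    (G.comap (e.symm (U, P))).Colorable 2
  have h1 : ((Finset.univ.filter fun f : Fin u ⊕ (Fin s ⊕ Fin s) → Fin n =>
      (G.comap f).Colorable 2).card : ℝ) =
      ∑ U, ((Finset.univ.filter fun P => Q U P).card : ℝ) := by
    rw [Finset.card_filter, ← e.symm.sum_comp, Fintype.sum_prod_type]
    push_cast
    refine Finset.sum_congr rfl fun U _ => ?_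
    rw [Finset.card_filter]
    push_cast
    rfl
  rw [h1]
  have hQ : ∀ U ∈ (Finset.univ : Finset (Fin u → Fin n)),
      ((Finset.univ.filter fun P => Q U P).card : ℝ) ≤
      (if η / 4 * n < ((Finset.univ.filter fun v => ∀ i, ¬ G.Adj v (U i)).card : ℝ) then
        (n : ℝ) ^ (s + s) else 0) + 2 ^ u * ((1 - η / 2) ^ s * n ^ (s + s)) := by
    intro U _
    have hpos : (0 : ℝ) ≤ 2 ^ u * ((1 - η / 2) ^ s * n ^ (s + s)) := by
      have : 0 ≤ 1 - η / 2 := by linarith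
      positivity
    split_ifs with hb
    · have : (Finset.univ.filter fun P => Q U P).card ≤ n ^ (s + s) := by
        refine (Finset.card_le_univ _).trans ?_
        simp [pow_add, mul_pow]
      have : ((Finset.univ.filter fun P => Q U P).card : ℝ) ≤ (n : ℝ) ^ (s + s) := by
        exact_mod_cast this
      linarith
    · rw [zero_add]
      let W : (Fin u → Bool) → Finset (Fin n × Fin n) := fun c =>
        Finset.univ.filter fun z : Fin n × Fin n => G.Adj z.1 z.2 ∧
          ∃ b, (∃ i, c i = b ∧ G.Adj z.1 (U i)) ∧ (∃ i, c i = b ∧ G.Adj z.2 (U i))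
      have hsub : (Finset.univ.filter fun P => Q U P) ⊆
          (Finset.univ : Finset (Fin u → Bool)).biUnion fun c =>
            Fintype.piFinset fun _ : Fin s => (W c)ᶜ := by
        intro P hP
        have hP : (G.comap (e.symm (U, P))).Colorable 2 := (Finset.mem_filter.mp hP).2
        obtain ⟨C⟩ := hP
        let C' : (G.comap (e.symm (U, P))).Coloring Bool :=
          (recolorOfEquiv _ finTwoEquiv) C
        rw [Finset.mem_biUnion]
        refine ⟨fun i => C' (Sum.inl i), Finset.mem_univ _, ?_⟩
        rw [Fintype.mem_piFinset]
        intro j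
        rw [Finset.mem_compl]
        intro hj
        obtain ⟨-, hadj, b, ⟨i1, hc1, ha1⟩, ⟨i2, hc2, ha2⟩⟩ := Finset.mem_filter.mp hj
        have v1 : C' (Sum.inr (Sum.inl j)) ≠ C' (Sum.inl i1) := C'.valid ha1
        have v2 : C' (Sum.inr (Sum.inr j)) ≠ C' (Sum.inl i2) := C'.valid ha2
        have v3 : C' (Sum.inr (Sum.inl j)) ≠ C' (Sum.inr (Sum.inr j)) := C'.valid hadj
        simp only at hc1 hc2
        rw [hc1] at v1
        rw [hc2] at v2
        revert v1 v2 v3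
        generalize C' (Sum.inr (Sum.inl j)) = p
        generalize C' (Sum.inr (Sum.inr j)) = q
        cases p <;> cases q <;> cases b <;> simp
      have hc : ∀ c ∈ (Finset.univ : Finset (Fin u → Bool)),
          ((Fintype.piFinset fun _ : Fin s => (W c)ᶜ).card : ℝ) ≤
            (1 - η / 2) ^ s * n ^ (s + s) := by
        intro c _
        rw [Fintype.card_piFinset]
        simp only [Finset.prod_const, Finset.card_univ, Fintype.card_fin]
        push_cast
        rw [pow_add, ← mul_pow, ← mul_pow]
        gcongr
        have h2 := viol_card n u G η hfar U c (not_lt.mp hb)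
        have h3 := Finset.card_add_card_compl (W c)
        simp only [Fintype.card_prod, Fintype.card_fin] at h3
        have h4 : ((W c).card : ℝ) + ((W c)ᶜ.card : ℝ) = n * n := by exact_mod_cast h3
        have h5 : η / 2 * n ^ 2 ≤ ((W c).card : ℝ) := h2
        nlinarith
      calc ((Finset.univ.filter fun P => Q U P).card : ℝ)
          ≤ ∑ c : Fin u → Bool, ((Fintype.piFinset fun _ : Fin s => (W c)ᶜ).card : ℝ) := by
            exact_mod_cast (Finset.card_le_card hsub).trans Finset.card_biUnion_le
        _ ≤ _ := (Finset.sum_le_sum hc).trans (by simp)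
  refine (Finset.sum_le_sum hQ).trans ?_
  rw [Finset.sum_add_distrib, ← Finset.sum_filter, Finset.sum_const, Finset.sum_const,
    nsmul_eq_mul, nsmul_eq_mul]
  have h6 := bad_card n u hn G η hη hdeg
  have h7 := mul_le_mul_of_nonneg_right h6 (by positivity : (0 : ℝ) ≤ (n : ℝ) ^ (s + s))
  simp only [Finset.card_univ, Fintype.card_pi, Fintype.card_fin, Finset.prod_const]
  push_cast
  rw [pow_add (n : ℝ) u]
  linarith

open Classical in
theorem main_aux {α : Type*} [Fintype α] (H : SimpleGraph α) (g : ℕ) (hg : 2 ≤ g)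
    (hmin : ∀ g' : ℕ, 0 < g' → g' < g → Nonempty (H →g cycleGraph (2 * g' + 1)))
    (η : ℝ) (hη : 0 < η) (hp : 2 / (2 * (g : ℝ) + 1) + η ≤ 1) :
    ∃ N : ℕ, ∀ n : ℕ, N ≤ n → ∀ G : SimpleGraph (Fin n), ¬ Copies H G →
      (∀ v, (2 / (2 * (g : ℝ) + 1) + η) * n ≤
        ((Finset.univ.filter fun w => G.Adj v w).card : ℝ)) →
      ¬ (∀ G' : SimpleGraph (Fin n), G' ≤ G → G'.Colorable 2 →
        η * n ^ 2 < ((G.edgeSet \ G'.edgeSet).ncard : ℝ)) := by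
  set q : ℝ := 2 / (2 * (g : ℝ) + 1) with hq
  have hq0 : 0 ≤ q := by positivity
  have hη1 : η ≤ 1 := by linarith
  obtain ⟨u, hu⟩ := exists_pow_lt_of_lt_one (by positivity : 0 < η / 16) (by linarith : 1 - η < 1)
  have hu' : 4 / η * (1 - η) ^ u ≤ 1 / 4 := by
    have := mul_le_mul_of_nonneg_left hu.le (by positivity : 0 ≤ 4 / η)
    refine this.trans (le_of_eq ?_)
    field_simp
    norm_num
  set r : ℝ := Real.exp (-(η ^ 2 / 4)) with hr
  have hr1 : r < 1 := by
    rw [hr, ← Real.exp_zero]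
    refine Real.exp_lt_exp.mpr ?_
    have : 0 < η ^ 2 := by positivity
    linarith
  have hs : ∃ s : ℕ, 2 ^ u * (1 - η / 2) ^ s < 1 / 4 ∧
      ((u + (s + s) : ℕ) : ℝ) * r ^ (u + (s + s)) < 1 / (4 * Real.exp 1) := by
    have t1 : Filter.Tendsto (fun s : ℕ => (2 : ℝ) ^ u * (1 - η / 2) ^ s) Filter.atTop
        (nhds (2 ^ u * 0)) :=
      (tendsto_pow_atTop_nhds_zero_of_lt_one (by linarith) (by linarith)).const_mul _
    rw [mul_zero] at t1
    have t2 := (tendsto_self_mul_const_pow_of_lt_one (Real.exp_pos _).le hr1).comp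
      (Filter.tendsto_atTop_mono (fun s => (by omega : s ≤ u + (s + s))) Filter.tendsto_id)
    exact ((t1.eventually_lt_const (by norm_num : (0 : ℝ) < 1 / 4)).and
      (t2.eventually_lt_const (by positivity : (0 : ℝ) < 1 / (4 * Real.exp 1)))).exists
  obtain ⟨s, hs1, hs2⟩ := hs
  let ι := Fin u ⊕ (Fin s ⊕ Fin s)
  have hcard : Fintype.card ι = u + (s + s) := by simp [ι]
  set M : ℕ := Fintype.card (α → ι) with hM
  set c : ℝ := 1 / (8 * ((M : ℝ) + 1)) with hc
  have hc0 : 0 < c := by positivity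
  choose N hN using fun h : α → ι => copy_of_density H h c hc0
  refine ⟨Finset.univ.sup N + 1, fun n hn G hfree hdeg hfar => ?_⟩
  have hn0 : 0 < n := by omega
  have hn0' : (0 : ℝ) < n := by exact_mod_cast hn0
  let S : (α → ι) → Finset (ι → Fin n) := fun h =>
    Finset.univ.filter fun f : ι → Fin n => ∀ a b, H.Adj a b → G.Adj (f (h a)) (f (h b))
  have hSlt : ∀ h ∈ (Finset.univ : Finset (α → ι)),
      ((S h).card : ℝ) ≤ c * (n : ℝ) ^ Fintype.card ι := by
    intro h _
    by_contra hcon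
    have hNn : N h ≤ n := by
      have := Finset.le_sup (f := N) (Finset.mem_univ h)
      omega
    exact hfree (hN h n hNn G (not_le.mp hcon).le)
  let L : ι → Finset (ι → Fin n) := fun i => Finset.univ.filter fun f : ι → Fin n =>
      ((Finset.univ.filter fun j => G.Adj (f i) (f j)).card : ℝ) ≤ q * Fintype.card ι
  let Bp : Finset (ι → Fin n) := Finset.univ.filter fun f => (G.comap f).Colorable 2
  have hcover : (Finset.univ : Finset (ι → Fin n)) ⊆
      Bp ∪ (Finset.univ.biUnion L ∪ Finset.univ.biUnion S) := by
    intro f _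
    by_cases h1 : f ∈ Bp
    · exact Finset.mem_union_left _ h1
    refine Finset.mem_union_right _ ?_
    by_cases h2 : f ∈ Finset.univ.biUnion L
    · exact Finset.mem_union_left _ h2
    refine Finset.mem_union_right _ ?_
    have hbip : ¬ (G.comap f).Colorable 2 := fun h =>
      h1 (Finset.mem_filter.mpr ⟨Finset.mem_univ _, h⟩)
    obtain ⟨k, hk0, hkg, ⟨φ⟩⟩ := aes (G.comap f) g hg hbip (by
      intro i
      have h3 : ¬ ((Finset.univ.filter fun j => G.Adj (f i) (f j)).card : ℝ) ≤
          q * Fintype.card ι := fun h => h2 (Finset.mem_biUnion.mpr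
        ⟨i, Finset.mem_univ _, Finset.mem_filter.mpr ⟨Finset.mem_univ _, h⟩⟩)
      have h3 := not_le.mp h3
      rw [hq, div_mul_eq_mul_div, div_lt_iff₀ (by positivity)] at h3
      have h4 : 2 * Fintype.card ι <
          (Finset.univ.filter fun j => G.Adj (f i) (f j)).card * (2 * g + 1) := by
        exact_mod_cast h3
      rw [mul_comm] at h4 ⊢
      rw [mul_comm (2 * g + 1)]
      simpa only [comap_adj] using h4)
    obtain ⟨ψ⟩ := hmin k hk0 hkg
    refine Finset.mem_biUnion.mpr ⟨fun a => φ (ψ a), Finset.mem_univ _,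
      Finset.mem_filter.mpr ⟨Finset.mem_univ _, fun a b hab => ?_⟩⟩
    exact φ.map_rel (ψ.map_rel hab)
  have htot : ((n : ℝ) ^ Fintype.card ι) ≤
      Bp.card + (∑ i, ((L i).card : ℝ) + ∑ h, ((S h).card : ℝ)) := by
    have h5 : n ^ Fintype.card ι ≤ Bp.card + (∑ i, (L i).card + ∑ h, (S h).card) := by
      calc n ^ Fintype.card ι = (Finset.univ : Finset (ι → Fin n)).card := by
            rw [Finset.card_univ, Fintype.card_fun, Fintype.card_fin]
        _ ≤ _ := (Finset.card_le_card hcover).trans ((Finset.card_union_le _ _).trans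
            (Nat.add_le_add_left ((Finset.card_union_le _ _).trans
              (Nat.add_le_add Finset.card_biUnion_le Finset.card_biUnion_le)) _))
    exact_mod_cast h5
  have hBp := bip_card n u s hn0 G η hη hη1 (fun v => by
    refine le_trans ?_ (hdeg v)
    have : 0 ≤ q * n := by positivity
    linarith) hfar
  have hL := Finset.sum_le_sum fun (i : ι) (_ : i ∈ Finset.univ) =>
    chernoff n G q η hq0 hη hp hdeg i
  have hSS := Finset.sum_le_sum hSlt
  rw [Finset.sum_const, nsmul_eq_mul, Finset.card_univ] at hL hSS
  rw [← hM] at hSS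
  rw [hcard] at hL hSS htot
  set X : ℝ := (n : ℝ) ^ (u + (s + s)) with hX
  have hX0 : 0 < X := by positivity
  have b1 : (Bp.card : ℝ) ≤ X * (1 / 4 + 1 / 4) := by
    refine hBp.trans ?_
    gcongr
  have b2 : ∑ i, ((L i).card : ℝ) ≤ X * (1 / 4) := by
    have h7 : Real.exp 1 * (((u + (s + s) : ℕ) : ℝ) * r ^ (u + (s + s))) ≤ 1 / 4 := by
      refine (mul_le_mul_of_nonneg_left hs2.le (Real.exp_pos 1).le).trans (le_of_eq ?_)
      field_simp
    have h8 := mul_le_mul_of_nonneg_left h7 hX0.le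
    have h9 : ∑ i, ((L i).card : ℝ) ≤
      ((u + (s + s) : ℕ) : ℝ) * (X * (Real.exp 1 * r ^ (u + (s + s)))) := by
      simpa only [L, hcard] using hL
    linarith
  have b3 : ∑ h, ((S h).card : ℝ) ≤ X * (1 / 8) := by
    have h6 : (M : ℝ) * c ≤ 1 / 8 := by
      rw [hc, mul_one_div, div_le_iff₀ (by positivity)]
      linarith
    nlinarith
  linarith

/-- For a 3-chromatic graph `H` with `g` minimal positive such that `H` is not homomorphic
to `C_{2g+1}`: for every `η > 0`, every sufficiently large `H`-free graph on `n` vertices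
with minimum degree at least `(2/(2g+1) + η) * n` can be made bipartite by deleting at
most `η * n ^ 2` edges. -/
theorem statement7 {α : Type*} [Fintype α] (H : SimpleGraph α)
    (hchi : H.chromaticNumber = 3) (g : ℕ) (hg : 0 < g)
    (hno : IsEmpty (H →g cycleGraph (2 * g + 1)))
    (hmin : ∀ g' : ℕ, 0 < g' → g' < g → Nonempty (H →g cycleGraph (2 * g' + 1)))
    (η : ℝ) (hη : 0 < η) :
    ∃ N : ℕ, ∀ n : ℕ, N ≤ n → ∀ G : SimpleGraph (Fin n), ¬ Copies H G →
      (∀ v, (2 / (2 * (g : ℝ) + 1) + η) * n ≤ ((G.neighborSet v).ncard : ℝ)) →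
      ∃ G' : SimpleGraph (Fin n), G' ≤ G ∧
        ((G.edgeSet \ G'.edgeSet).ncard : ℝ) ≤ η * n ^ 2 ∧ G'.Colorable 2 := by
  classical
  have hg2 : 2 ≤ g := by
    by_contra hlt
    obtain rfl : g = 1 := by omega
    have h3 : H.Colorable 3 := chromaticNumber_le_iff_colorable.mp (le_of_eq hchi)
    obtain ⟨C⟩ := h3
    have h4 : cycleGraph (2 * 1 + 1) = ⊤ := cycleGraph_three_eq_top
    rw [h4] at hno
    exact hno.false C
  by_cases hp : 2 / (2 * (g : ℝ) + 1) + η ≤ 1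
  · obtain ⟨N, hN⟩ := main_aux H g hg2 hmin η hη hp
    refine ⟨N, fun n hn G hfree hdeg => ?_⟩
    by_contra hcon
    push Not at hcon
    refine hN n hn G hfree (fun v => ?_) (fun G' hG' hcol => ?_)
    · have h1 : G.neighborSet v = ((Finset.univ.filter fun w => G.Adj v w : Finset (Fin n)) :
          Set (Fin n)) := by ext w; simp
      have h2 := hdeg v
      rwa [h1, Set.ncard_coe_finset] at h2
    · by_contra hle
      exact hcon G' hG' (not_lt.mp hle) hcol
  · refine ⟨1, fun n hn G _ hdeg => ?_⟩
    exfalso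
    have h1 := hdeg ⟨0, by omega⟩
    have h2 : (G.neighborSet ⟨0, by omega⟩).ncard ≤ n := by
      have := Set.ncard_le_card (G.neighborSet (⟨0, by omega⟩ : Fin n))
      simpa using this
    have h3 : ((G.neighborSet ⟨0, by omega⟩).ncard : ℝ) ≤ n := by exact_mod_cast h2
    have h4 : (0 : ℝ) < n := by exact_mod_cast (by omega : 0 < n)
    nlinarith [not_le.mp hp]
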